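/- Let d > 0 and ω, L > 0. Let a : ℝ² → ℝ be bounded, continuous, locally Hölder continuous, ω-periodic in t and L-periodic in x. Let φ₁ ∈ C^{1,2}(ℝ²) be positive, ω-periodic in t, L-periodic in x, and satisfy (φ₁)_t − d(φ₁)_xx = a(t,x)φ₁ on ℝ². Let T₀ ∈ ℝ and M₀ > 0, and let W be a classical solution of W_t − dW_xx = a(t,x)W on (T₀,∞) × ℝ, continuous on [T₀,∞) × ℝ, such that W(T₀,·) is compactly supported, 0 ≤ W(t,x) ≤ M₀ φ₁(t,x) for all t ≥ T₀ and x ∈ ℝ, and for each fixed t > T₀, W(t,x) → 0 as |x| → ∞. Then W(t,x) → 0 as t → ∞, uniformly in x ∈ ℝ. -/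

import Mathlib

open Filter Topology Set

noncomputable section

/-- `u` solves `u_t = d u_xx + f(t,x,u)` classically at every point `(t,x)` of the set `s`:
the spatial function is twice differentiable there and the time derivative exists and
equals `d u_xx + f(t,x,u)`. -/
def SolvesPDE (d : ℝ) (f : ℝ → ℝ → ℝ → ℝ) (u : ℝ → ℝ → ℝ) (s : Set (ℝ × ℝ)) : Prop :=
  ∀ q ∈ s,
    DifferentiableAt ℝ (u q.1) q.2 ∧
    DifferentiableAt ℝ (deriv (u q.1)) q.2 ∧
    HasDerivAt (fun t => u t q.2)
      (d * deriv (deriv (u q.1)) q.2 + f q.1 q.2 (u q.1 q.2)) q.1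


namespace LPD

/-- `f` is differentiable and has second derivative `q` at `x`. -/
def D2 (f : ℝ → ℝ) (x q : ℝ) : Prop :=
  ∃ f' : ℝ → ℝ, (∀ y, HasDerivAt f (f' y) y) ∧ HasDerivAt f' q x

lemma D2.add {f g : ℝ → ℝ} {x p q : ℝ} (hf : D2 f x p) (hg : D2 g x q) :
    D2 (fun y => f y + g y) x (p + q) := by
  obtain ⟨f', h1, h2⟩ := hf
  obtain ⟨g', h3, h4⟩ := hg
  exact ⟨fun y => f' y + g' y, fun y => (h1 y).fun_add (h3 y), h2.fun_add h4⟩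

lemma D2.const_mul {f : ℝ → ℝ} {x p : ℝ} (c : ℝ) (hf : D2 f x p) :
    D2 (fun y => c * f y) x (c * p) := by
  obtain ⟨f', h1, h2⟩ := hf
  exact ⟨fun y => c * f' y, fun y => (h1 y).const_mul c, h2.const_mul c⟩

lemma D2.const (c x : ℝ) : D2 (fun _ => c) x 0 :=
  ⟨fun _ => 0, fun y => hasDerivAt_const y c, hasDerivAt_const x 0⟩

lemma D2.comp_add {f : ℝ → ℝ} {x p c : ℝ} (hf : D2 f (x + c) p) :
    D2 (fun y => f (y + c)) x p := by
  obtain ⟨f', h1, h2⟩ := hf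
  exact ⟨fun y => f' (y + c), fun y => (h1 (y + c)).comp_add_const y c, h2.comp_add_const x c⟩

lemma D2.comp_sub {f : ℝ → ℝ} {x p c : ℝ} (hf : D2 f (c - x) p) :
    D2 (fun y => f (c - y)) x p := by
  obtain ⟨f', h1, h2⟩ := hf
  refine ⟨fun y => - f' (c - y), fun y => (h1 (c - y)).comp_const_sub c y, ?_⟩
  simpa using (h2.comp_const_sub c x).fun_neg

lemma D2.nonneg_of_min {f : ℝ → ℝ} {x q : ℝ} (hf : D2 f x q) (hm : IsLocalMin f x) : 0 ≤ q := by
  obtain ⟨f', h1, h2⟩ := hf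
  have hd : deriv f = f' := funext fun y => (h1 y).deriv
  have h0 : f' x = 0 := hm.hasDerivAt_eq_zero (h1 x)
  by_contra hq
  push Not at hq
  have hmax : IsLocalMax f x := by
    apply isLocalMax_of_deriv_deriv_neg
    · rw [hd, h2.deriv]; exact hq
    · rw [hd]; exact h0
    · exact (h1 x).continuousAt
  have he : f =ᶠ[𝓝 x] fun _ => f x := by
    filter_upwards [hm, hmax] with y hy1 hy2
    exact le_antisymm hy2 hy1
  have he2 := he.deriv.deriv_eq
  rw [hd, h2.deriv] at he2
  simp at he2
  linarith

lemma deriv_nonpos_of_left {f : ℝ → ℝ} {t p : ℝ} (hf : HasDerivAt f p t)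
    (h : ∀ᶠ s in 𝓝[<] t, f t ≤ f s) : p ≤ 0 := by
  have h1 : Tendsto (slope f t) (𝓝[<] t) (𝓝 p) :=
    (hasDerivWithinAt_iff_tendsto_slope' (by simp)).1 (hf.hasDerivWithinAt (s := Iio t))
  refine le_of_tendsto h1 ?_
  filter_upwards [h, self_mem_nhdsWithin] with s hs hst
  rw [slope_def_field]
  exact div_nonpos_of_nonneg_of_nonpos (by linarith) (by simp at hst; linarith)

/-- Maximum principle on a compact set. -/
lemma mp {d A : ℝ} (hd : 0 < d) (K : Set (ℝ × ℝ)) (hK : IsCompact K) (z : ℝ → ℝ → ℝ)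
    (hz : ContinuousOn (fun q : ℝ × ℝ => z q.1 q.2) K)
    (h : ∀ t x, (t, x) ∈ K → z t x < 0 →
      (∀ᶠ y in 𝓝 x, (t, y) ∈ K) ∧ (∀ᶠ s in 𝓝[<] t, (s, x) ∈ K) ∧
      ∃ p q, D2 (z t) x q ∧ HasDerivAt (fun s => z s x) p t ∧ A * z t x ≤ p - d * q) :
    ∀ t x, (t, x) ∈ K → 0 ≤ z t x := by
  by_contra hcon
  push Not at hcon
  obtain ⟨t₁, x₁, hm₁, hneg₁⟩ := hcon
  have hc : ContinuousOn (fun q : ℝ × ℝ => Real.exp (-(A + 1) * q.1) * z q.1 q.2) K :=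
    (Continuous.continuousOn (by fun_prop)).mul hz
  obtain ⟨⟨t, x⟩, hm, hmin⟩ := hK.exists_isMinOn ⟨_, hm₁⟩ hc
  rw [isMinOn_iff] at hmin
  have hneg : z t x < 0 := by
    have h1 := hmin _ hm₁
    simp only at h1
    have h2 : Real.exp (-(A + 1) * t₁) * z t₁ x₁ < 0 :=
      mul_neg_of_pos_of_neg (Real.exp_pos _) hneg₁
    have h3 : Real.exp (-(A + 1) * t) * z t x < 0 := by linarith
    by_contra h4
    push Not at h4
    have := mul_nonneg (Real.exp_pos (-(A + 1) * t)).le h4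
    linarith
  obtain ⟨e1, e2, p, q, hq, hp, hle⟩ := h t x hm hneg
  have hq0 : 0 ≤ q := by
    apply hq.nonneg_of_min
    filter_upwards [e1] with y hy
    have := hmin _ hy
    simp only at this
    exact le_of_mul_le_mul_left this (Real.exp_pos _)
  have hD : HasDerivAt (fun s => Real.exp (-(A + 1) * s) * z s x)
      (Real.exp (-(A + 1) * t) * (-(A + 1)) * z t x + Real.exp (-(A + 1) * t) * p) t := by
    have h1 : HasDerivAt (fun s => Real.exp (-(A + 1) * s))
      (Real.exp (-(A + 1) * t) * (-(A + 1))) t := by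
      have := ((hasDerivAt_id t).const_mul (-(A + 1))).exp
      simpa using this
    exact h1.mul hp
  have hle0 := deriv_nonpos_of_left hD (by
    filter_upwards [e2] with s hs
    exact hmin _ hs)
  have h5 : Real.exp (-(A + 1) * t) * (p - (A + 1) * z t x) ≤ 0 := by
    linarith
  have h6 : p - (A + 1) * z t x ≤ 0 := by
    by_contra h7
    push Not at h7
    have := mul_pos (Real.exp_pos (-(A + 1) * t)) h7
    linarith
  have h8 := mul_nonneg hd.le hq0
  nlinarith

/-- Classical solutions of the linear equation. -/
def Good (d : ℝ) (a : ℝ → ℝ → ℝ) (T₀ : ℝ) (u : ℝ → ℝ → ℝ) : Prop :=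
  ContinuousOn (fun q : ℝ × ℝ => u q.1 q.2) {q : ℝ × ℝ | T₀ ≤ q.1} ∧
  ∀ t, T₀ < t → ∀ x, ∃ q, D2 (u t) x q ∧ HasDerivAt (fun s => u s x) (d * q + a t x * u t x) t

lemma Good.add {d T₀ : ℝ} {a u v : ℝ → ℝ → ℝ} (hu : Good d a T₀ u) (hv : Good d a T₀ v) :
    Good d a T₀ (fun t x => u t x + v t x) := by
  refine ⟨hu.1.add hv.1, fun t ht x => ?_⟩
  obtain ⟨p, h1, h2⟩ := hu.2 t ht x
  obtain ⟨q, h3, h4⟩ := hv.2 t ht x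
  refine ⟨p + q, h1.add h3, ?_⟩
  exact (h2.fun_add h4).congr_deriv (by ring)

lemma Good.const_mul {d T₀ : ℝ} {a u : ℝ → ℝ → ℝ} (c : ℝ) (hu : Good d a T₀ u) :
    Good d a T₀ (fun t x => c * u t x) := by
  refine ⟨continuousOn_const.mul hu.1, fun t ht x => ?_⟩
  obtain ⟨p, h1, h2⟩ := hu.2 t ht x
  refine ⟨c * p, h1.const_mul c, ?_⟩
  exact (h2.const_mul c).congr_deriv (by ring)

lemma Good.zero {d T₀ : ℝ} {a : ℝ → ℝ → ℝ} : Good d a T₀ (fun _ _ => 0) := by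
  refine ⟨continuousOn_const, fun t ht x => ⟨0, D2.const 0 x, ?_⟩⟩
  simpa using hasDerivAt_const t (0 : ℝ)

lemma Good.sum {d T₀ : ℝ} {a : ℝ → ℝ → ℝ} {ι : Type} (s : Finset ι) (u : ι → ℝ → ℝ → ℝ)
    (hu : ∀ i, Good d a T₀ (u i)) : Good d a T₀ (fun t x => ∑ i ∈ s, u i t x) := by
  classical
  induction s using Finset.induction_on with
  | empty => simpa using Good.zero
  | insert i s hi ih =>
    simp only [Finset.sum_insert hi]
    exact (hu i).add ih

lemma Good.shift_x {d T₀ : ℝ} {a u : ℝ → ℝ → ℝ} {c : ℝ} (hc : ∀ t x, a t (x + c) = a t x)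
    (hu : Good d a T₀ u) : Good d a T₀ (fun t x => u t (x + c)) := by
  refine ⟨?_, fun t ht x => ?_⟩
  · exact hu.1.comp (f := fun q : ℝ × ℝ => (q.1, q.2 + c))
      (Continuous.continuousOn (by fun_prop)) (fun q hq => hq)
  · obtain ⟨p, h1, h2⟩ := hu.2 t ht (x + c)
    refine ⟨p, h1.comp_add, ?_⟩
    rw [← hc t x]
    exact h2

lemma Good.shift_t {d T₀ : ℝ} {a u : ℝ → ℝ → ℝ} {c : ℝ} (hc0 : 0 ≤ c)
    (hc : ∀ t x, a (t + c) x = a t x)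
    (hu : Good d a T₀ u) : Good d a T₀ (fun t x => u (t + c) x) := by
  refine ⟨?_, fun t ht x => ?_⟩
  · refine hu.1.comp (f := fun q : ℝ × ℝ => (q.1 + c, q.2))
      (Continuous.continuousOn (by fun_prop)) (fun q hq => ?_)
    simp at hq ⊢
    linarith
  · obtain ⟨p, h1, h2⟩ := hu.2 (t + c) (by linarith) x
    refine ⟨p, h1, ?_⟩
    rw [← hc t x]
    exact h2.comp_add_const t c

/-- Comparison of a solution with an explicit supersolution. -/
lemma mpsol {d A T₀ t₀ : ℝ} (hd : 0 < d) {a u : ℝ → ℝ → ℝ} (hA : ∀ t x, |a t x| ≤ A)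
    (hu : Good d a T₀ u) (ht₀ : T₀ ≤ t₀)
    (K : Set (ℝ × ℝ)) (hK : IsCompact K) (hKt : ∀ q ∈ K, t₀ ≤ q.1)
    (g gt gxx : ℝ → ℝ → ℝ) (hg : Continuous (fun q : ℝ × ℝ => g q.1 q.2))
    (hgx : ∀ t x, D2 (g t) x (gxx t x)) (hgt : ∀ t x, HasDerivAt (fun s => g s x) (gt t x) t)
    (h : ∀ t x, (t, x) ∈ K → u t x + g t x < 0 → t₀ < t ∧
      (∀ᶠ y in 𝓝 x, (t, y) ∈ K) ∧ (∀ᶠ s in 𝓝[<] t, (s, x) ∈ K) ∧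
      0 ≤ gt t x - d * gxx t x - a t x * g t x) :
    ∀ t x, (t, x) ∈ K → 0 ≤ u t x + g t x := by
  refine mp (A := A) hd K hK (fun t x => u t x + g t x) ?_ ?_
  · exact (hu.1.mono (fun q hq => ht₀.trans (hKt q hq))).add hg.continuousOn
  · intro t x hm hneg
    obtain ⟨h1, h2, h3, h4⟩ := h t x hm hneg
    obtain ⟨q, h5, h6⟩ := hu.2 t (by linarith) x
    refine ⟨h2, h3, _, _, h5.add (hgx t x), h6.fun_add (hgt t x), ?_⟩
    have h7 := (abs_le.1 (hA t x)).2
    nlinarith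

end LPD

namespace LPD

lemma hexp (k t₀ t : ℝ) : HasDerivAt (fun s => Real.exp (k * (s - t₀)))
    (Real.exp (k * (t - t₀)) * k) t := by
  have h := (((hasDerivAt_id t).sub_const t₀).const_mul k).exp
  simpa using h

lemma D2.quad (p q r x : ℝ) : D2 (fun y => p + q * y + r * y ^ 2) x (2 * r) := by
  refine ⟨fun y => q + 2 * r * y, fun y => ?_, ?_⟩
  · have h1 := ((hasDerivAt_id y).const_mul q).const_add p
    have h2 := ((hasDerivAt_id y).pow 2).const_mul r
    exact (h1.fun_add h2).congr_deriv (by simp; ring)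
  · have h1 := ((hasDerivAt_id x).const_mul (2 * r)).const_add q
    exact h1.congr_deriv (by simp)

/-- Interior Lipschitz estimate. -/
lemma lip {d A T₀ t₀ τ M c r : ℝ} (hd : 0 < d) {a u : ℝ → ℝ → ℝ} (hA : ∀ t x, |a t x| ≤ A)
    (hτ : 0 < τ) (hu : Good d a T₀ u) (ht₀ : T₀ ≤ t₀)
    (hM : ∀ t ∈ Icc t₀ (t₀ + τ), ∀ x, |x - c| ≤ 1 → |u t x| ≤ M) (hr : r ∈ Icc (0 : ℝ) 1) :
    u (t₀ + τ) (r + c) - u (t₀ + τ) (c - r) ≤ 2 * ((1 + A * τ) / d + 2 * τ) / τ * M * r := by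
  have hA0 : 0 ≤ A := (abs_nonneg _).trans (hA 0 0)
  have hM0 : 0 ≤ M := (abs_nonneg _).trans (hM t₀ (by simp [hτ.le]) c (by simp))
  set C := (1 + A * τ) / d + 2 * τ with hC
  have hC0 : 0 ≤ C := by positivity
  have key := mp (A := A) hd (Icc t₀ (t₀ + τ) ×ˢ Icc (0 : ℝ) 1) (isCompact_Icc.prod isCompact_Icc)
    (fun t r => (0 + (2 * (C * M)) * r + (-(C * M)) * r ^ 2)
      + (-(t - t₀)) * (u t (r + c) + (-1) * u t (c - r))) ?_ ?_
  · have := key (t₀ + τ) r ⟨by simp [hτ.le], hr⟩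
    have h2 : τ * (u (t₀ + τ) (r + c) - u (t₀ + τ) (c - r)) ≤ 2 * C * M * r := by
      nlinarith [mul_nonneg (mul_nonneg hC0 hM0) (sq_nonneg r)]
    have h3 : 2 * C / τ * M * r = (2 * C * M * r) / τ := by ring
    rw [h3, le_div_iff₀ hτ]
    linarith
  · have c1 : ContinuousOn (fun q : ℝ × ℝ => u q.1 (q.2 + c)) (Icc t₀ (t₀ + τ) ×ˢ Icc (0 : ℝ) 1) :=
      hu.1.comp (f := fun q : ℝ × ℝ => (q.1, q.2 + c)) (Continuous.continuousOn (by fun_prop))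
        (fun q hq => ht₀.trans hq.1.1)
    have c2 : ContinuousOn (fun q : ℝ × ℝ => u q.1 (c - q.2)) (Icc t₀ (t₀ + τ) ×ˢ Icc (0 : ℝ) 1) :=
      hu.1.comp (f := fun q : ℝ × ℝ => (q.1, c - q.2)) (Continuous.continuousOn (by fun_prop))
        (fun q hq => ht₀.trans hq.1.1)
    exact (Continuous.continuousOn (by fun_prop)).add
      ((Continuous.continuousOn (by fun_prop)).mul (c1.add (continuousOn_const.mul c2)))
  · rintro t r ⟨ht, hr⟩ hneg
    simp only at ht hr hneg
    have b1 := abs_le.1 (hM t ht (r + c) (by rw [abs_le]; constructor <;> linarith [hr.1, hr.2]))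
    have b2 := abs_le.1 (hM t ht (c - r) (by rw [abs_le]; constructor <;> linarith [hr.1, hr.2]))
    have hCM := mul_nonneg hC0 hM0
    have hCτ : 2 * τ * M ≤ C * M := by
      apply mul_le_mul_of_nonneg_right _ hM0
      have : 0 ≤ (1 + A * τ) / d := by positivity
      linarith
    have hr0 : 0 < r := by
      rcases hr.1.lt_or_eq with h | h
      · exact h
      · subst h; simp at hneg
    have hr1 : r < 1 := by
      rcases hr.2.lt_or_eq with h | h
      · exact h
      · subst h
        nlinarith [ht.1, ht.2]
    have ht1 : t₀ < t := by
      rcases ht.1.lt_or_eq with h | h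
      · exact h
      · subst h
        rw [sub_self] at hneg
        have := mul_nonneg hCM (mul_nonneg hr0.le (by linarith : 0 ≤ 2 - r))
        linarith
    refine ⟨?_, ?_, ?_⟩
    · filter_upwards [Ioo_mem_nhds hr0 hr1] with y hy
      exact ⟨ht, hy.1.le, hy.2.le⟩
    · filter_upwards [Ioo_mem_nhdsLT ht1] with s hs
      exact ⟨⟨hs.1.le, hs.2.le.trans ht.2⟩, hr⟩
    · obtain ⟨p, h1, h2⟩ := hu.2 t (by linarith) (r + c)
      obtain ⟨q, h3, h4⟩ := hu.2 t (by linarith) (c - r)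
      refine ⟨_, _, (D2.quad _ _ _ _).add ((h1.comp_add.add (h3.comp_sub.const_mul (-1))).const_mul _),
        (((hasDerivAt_id t).sub_const t₀).fun_neg.fun_mul
          (h2.fun_add (h4.const_mul (-1)))).const_add _, ?_⟩
      have e : C * d = 1 + A * τ + 2 * τ * d := by rw [hC]; field_simp
      have e2 : (1 + A * τ) * M ≤ d * (C * M) := by
        have : 0 ≤ 2 * τ * d * M := by positivity
        nlinarith
      have a1 : |a t (r + c) * u t (r + c)| ≤ A * M := by
        rw [abs_mul]; exact mul_le_mul (hA _ _) (abs_le.2 b1) (abs_nonneg _) hA0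
      have a2 : |a t (c - r) * u t (c - r)| ≤ A * M := by
        rw [abs_mul]; exact mul_le_mul (hA _ _) (abs_le.2 b2) (abs_nonneg _) hA0
      have a1' := abs_le.1 a1
      have a2' := abs_le.1 a2
      have hz := mul_nonpos_of_nonneg_of_nonpos hA0 hneg.le
      have a3 : (t - t₀) * (a t (r + c) * u t (r + c) - a t (c - r) * u t (c - r)) ≤ τ * (2 * (A * M)) := by
        have hAM : 0 ≤ A * M := by positivity
        calc _ ≤ (t - t₀) * (2 * (A * M)) := by
              apply mul_le_mul_of_nonneg_left _ (by linarith)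
              linarith
          _ ≤ _ := by
              apply mul_le_mul_of_nonneg_right _ (by linarith)
              linarith [ht.2]
      simp only [id]
      linarith

/-- Expanding lower barrier. -/
lemma lower {d A T₀ t₀ τ δ η ρ R y : ℝ} (hd : 0 < d) {a u : ℝ → ℝ → ℝ} (hA : ∀ t x, |a t x| ≤ A)
    (hτ : 0 < τ) (hu : Good d a T₀ u) (ht₀ : T₀ ≤ t₀) (hδ : 0 ≤ δ) (hη : 0 ≤ η) (hρ : 0 < ρ)
    (h0 : ∀ t ∈ Icc t₀ (t₀ + τ), ∀ x, (x - y) ^ 2 ≤ ρ ^ 2 + R ^ 2 → -δ ≤ u t x)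
    (h1 : ∀ x, |x - y| ≤ ρ → η ≤ u t₀ x) (x : ℝ) (hx : |x - y| ≤ R) :
    η * Real.exp (-(A + (R ^ 2 / τ + 6 * d) ^ 2 / (8 * d * ρ ^ 2)) * τ) - δ * Real.exp (A * τ)
      ≤ u (t₀ + τ) x := by
  have hA0 : 0 ≤ A := (abs_nonneg _).trans (hA 0 0)
  set v := R ^ 2 / τ with hv
  have hv0 : 0 ≤ v := by positivity
  have hvτ : v * τ = R ^ 2 := by rw [hv]; field_simp
  set k := A + (v + 6 * d) ^ 2 / (8 * d * ρ ^ 2) with hk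
  set κ := η / ρ ^ 4 with hκ
  have hκ0 : 0 ≤ κ := by positivity
  have hκρ : κ * ρ ^ 4 = η := by rw [hκ]; field_simp
  set Q : ℝ → ℝ → ℝ := fun t x => ρ ^ 2 + v * (t - t₀) - (x - y) ^ 2 with hQ
  have hQc : Continuous (fun q : ℝ × ℝ => Q q.1 q.2) := by simp only [hQ]; fun_prop
  have hxR : (x - y) ^ 2 ≤ R ^ 2 := by
    rw [← sq_abs]; exact pow_le_pow_left₀ (abs_nonneg _) hx 2
  set K : Set (ℝ × ℝ) := {q | q.1 ∈ Icc t₀ (t₀ + τ) ∧ 0 ≤ Q q.1 q.2} with hKdef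
  have hKsq : ∀ t x, (t, x) ∈ K → (x - y) ^ 2 ≤ ρ ^ 2 + R ^ 2 := by
    rintro t x ⟨h1, h2⟩
    simp only [hQ] at h1 h2
    nlinarith [h1.1, h1.2]
  have hK : IsCompact K := by
    apply IsCompact.of_isClosed_subset (s := Icc t₀ (t₀ + τ) ×ˢ Icc (y - (ρ ^ 2 + R ^ 2 + 1)) (y + (ρ ^ 2 + R ^ 2 + 1)))
      (isCompact_Icc.prod isCompact_Icc)
    · exact (isClosed_Icc.preimage continuous_fst).inter (isClosed_Ici.preimage hQc)
    · rintro ⟨t, x⟩ h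
      have h3 := hKsq t x h
      refine ⟨h.1, ?_⟩
      constructor <;> simp only <;> nlinarith [sq_nonneg (x - y - 1), sq_nonneg (x - y + 1)]
  have key := mpsol hd hA hu ht₀ K hK (fun q hq => hq.1.1)
    (fun t x => δ * Real.exp (A * (t - t₀)) + (-κ) * (Real.exp (-k * (t - t₀)) * (Q t x) ^ 2))
    (fun t x => δ * (Real.exp (A * (t - t₀)) * A) + (-κ) * (Real.exp (-k * (t - t₀)) * (-k) * (Q t x) ^ 2
      + Real.exp (-k * (t - t₀)) * (2 * Q t x * v)))
    (fun t x => (-κ * Real.exp (-k * (t - t₀))) * (8 * (x - y) ^ 2 - 4 * Q t x)) ?_ ?_ ?_ ?_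
  · have hm : (t₀ + τ, x) ∈ K := by
      refine ⟨by simp [hτ.le], ?_⟩
      simp only [hQ]
      nlinarith
    have h2 := key _ _ hm
    simp only [add_sub_cancel_left] at h2
    have h3 : ρ ^ 2 ≤ Q (t₀ + τ) x := by
      simp only [hQ]; nlinarith
    have h4 : ρ ^ 4 ≤ (Q (t₀ + τ) x) ^ 2 := by
      calc ρ ^ 4 = (ρ ^ 2) ^ 2 := by ring
        _ ≤ _ := pow_le_pow_left₀ (by positivity) h3 2
    have h5 : η * Real.exp (-k * τ) ≤ κ * (Real.exp (-k * τ) * (Q (t₀ + τ) x) ^ 2) := by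
      rw [← hκρ]
      calc κ * ρ ^ 4 * Real.exp (-k * τ) = κ * (Real.exp (-k * τ) * ρ ^ 4) := by ring
        _ ≤ _ := by gcongr
    linarith
  · simp only [hQ]; fun_prop
  · intro t x
    have hq : D2 (fun x => (Q t x) ^ 2) x (8 * (x - y) ^ 2 - 4 * Q t x) := by
      refine ⟨fun x => -4 * Q t x * (x - y), fun x => ?_, ?_⟩
      · have h1 : HasDerivAt (fun x => Q t x) (-(2 * (x - y))) x := by
          have := ((((hasDerivAt_id x).sub_const y).pow 2).const_sub (ρ ^ 2 + v * (t - t₀)))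
          exact this.congr_deriv (by simp)
        exact (h1.fun_pow 2).congr_deriv (by simp; ring)
      · have h1 : HasDerivAt (fun x => Q t x) (-(2 * (x - y))) x := by
          have := ((((hasDerivAt_id x).sub_const y).pow 2).const_sub (ρ ^ 2 + v * (t - t₀)))
          exact this.congr_deriv (by simp)
        have h2 := (h1.const_mul (-4)).fun_mul ((hasDerivAt_id x).sub_const y)
        exact h2.congr_deriv (by simp; ring)
    have h2 := (D2.const (δ * Real.exp (A * (t - t₀))) x).add
      ((hq.const_mul (Real.exp (-k * (t - t₀)))).const_mul (-κ))
    convert h2 using 1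
    ring
  · intro t x
    have h1 : HasDerivAt (fun t => Q t x) v t := by
      have := ((((hasDerivAt_id t).sub_const t₀).const_mul v).const_add (ρ ^ 2)).sub_const ((x - y) ^ 2)
      exact this.congr_deriv (by simp)
    have h2 := ((hexp A t₀ t).const_mul δ).fun_add
      (((hexp (-k) t₀ t).fun_mul (h1.fun_pow 2)).const_mul (-κ))
    exact h2.congr_deriv (by simp)
  · intro t x hm hneg
    have hsq := hKsq t x hm
    obtain ⟨ht, hq⟩ := hm
    simp only at ht hq
    have hu0 := h0 t ht x hsq
    have he1 : 1 ≤ Real.exp (A * (t - t₀)) := Real.one_le_exp (mul_nonneg hA0 (by linarith [ht.1]))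
    have hE := Real.exp_pos (-k * (t - t₀))
    have hq0 : 0 < Q t x := by
      rcases hq.lt_or_eq with h | h
      · exact h
      · rw [← h] at hneg
        nlinarith
    have ht1 : t₀ < t := by
      rcases ht.1.lt_or_eq with h | h
      · exact h
      · exfalso
        subst h
        have hQ0 : Q t₀ x = ρ ^ 2 - (x - y) ^ 2 := by simp [hQ]
        have h2 : η ≤ u t₀ x := by
          apply h1
          apply abs_le_of_sq_le_sq _ hρ.le
          linarith
        have h3 : (Q t₀ x) ^ 2 ≤ (ρ ^ 2) ^ 2 :=
          pow_le_pow_left₀ hq (by rw [hQ0]; nlinarith [sq_nonneg (x - y)]) 2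
        have h4 : κ * (Q t₀ x) ^ 2 ≤ κ * (ρ ^ 2) ^ 2 := mul_le_mul_of_nonneg_left h3 hκ0
        have h5 : κ * (ρ ^ 2) ^ 2 = η := by rw [← hκρ]; ring
        simp at hneg
        linarith
    refine ⟨ht1, ?_, ?_, ?_⟩
    · have : ContinuousAt (fun z => Q t z) x := by simp only [hQ]; fun_prop
      filter_upwards [this.eventually (lt_mem_nhds hq0)] with z hz
      exact ⟨ht, le_of_lt hz⟩
    · have : ContinuousAt (fun s => Q s x) t := by simp only [hQ]; fun_prop
      filter_upwards [Ioo_mem_nhdsLT ht1, nhdsWithin_le_nhds (this.eventually (lt_mem_nhds hq0))] with s hs hz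
      exact ⟨⟨hs.1.le, hs.2.le.trans ht.2⟩, le_of_lt hz⟩
    · have ha := abs_le.1 (hA t x)
      have hX : ρ ^ 2 - Q t x ≤ (x - y) ^ 2 := by
        have := mul_nonneg hv0 (by linarith : 0 ≤ t - t₀)
        simp only [hQ]; linarith
      set q := Q t x
      set E := Real.exp (-k * (t - t₀))
      have hmain : 0 ≤ (k - A) * q ^ 2 - 2 * (v + 6 * d) * q + 8 * d * ρ ^ 2 := by
        have e1 : (k - A) * q ^ 2 - 2 * (v + 6 * d) * q + 8 * d * ρ ^ 2
            = ((v + 6 * d) * q - 8 * d * ρ ^ 2) ^ 2 / (8 * d * ρ ^ 2) := by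
          rw [hk]; field_simp; ring
        rw [e1]; positivity
      have h7 : 0 ≤ (k + a t x) * q ^ 2 - 2 * v * q + d * (8 * (x - y) ^ 2 - 4 * q) := by
        have := mul_nonneg (by linarith : 0 ≤ a t x + A) (sq_nonneg q)
        have := mul_le_mul_of_nonneg_left hX hd.le
        linarith
      have h8 := mul_nonneg (mul_nonneg hκ0 hE.le) h7
      have h9 := mul_nonneg (mul_nonneg hδ (Real.exp_pos (A * (t - t₀))).le) (by linarith : 0 ≤ A - a t x)
      linarith

/-- Comparison on a large box. -/
lemma line {d A T₀ t₀ T R M : ℝ} (hd : 0 < d) {a u : ℝ → ℝ → ℝ} (hA : ∀ t x, |a t x| ≤ A)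
    (hu : Good d a T₀ u) (ht₀ : T₀ ≤ t₀) (hM : 0 ≤ M)
    (g gt gxx : ℝ → ℝ → ℝ) (hg : Continuous (fun q : ℝ × ℝ => g q.1 q.2))
    (hgx : ∀ t x, D2 (g t) x (gxx t x)) (hgt : ∀ t x, HasDerivAt (fun s => g s x) (gt t x) t)
    (hg0 : ∀ t x, 0 ≤ g t x) (hsup : ∀ t x, 0 ≤ gt t x - d * gxx t x - a t x * g t x)
    (h0 : ∀ t ∈ Icc t₀ T, ∀ x, |x| ≤ R → -M ≤ u t x)
    (h1 : ∀ x, |x| ≤ R → 0 ≤ u t₀ x + g t₀ x) (t : ℝ) (ht : t ∈ Icc t₀ T) (x : ℝ) (hx : |x| ≤ R) :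
    0 ≤ u t x + (g t x + M / (1 + R ^ 2) * (Real.exp ((2 * d + A) * (t - t₀)) * (1 + x ^ 2))) := by
  have hA0 : 0 ≤ A := (abs_nonneg _).trans (hA 0 0)
  set μ := M / (1 + R ^ 2) with hμ
  have hμ0 : 0 ≤ μ := by positivity
  have hμR : μ * (1 + R ^ 2) = M := by rw [hμ]; field_simp
  refine mpsol hd hA hu ht₀ (Icc t₀ T ×ˢ Icc (-R) R) (isCompact_Icc.prod isCompact_Icc)
    (fun q hq => hq.1.1)
    (fun t x => g t x + μ * (Real.exp ((2 * d + A) * (t - t₀)) * (1 + x ^ 2)))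
    (fun t x => gt t x + μ * (Real.exp ((2 * d + A) * (t - t₀)) * (2 * d + A) * (1 + x ^ 2)))
    (fun t x => gxx t x + μ * (Real.exp ((2 * d + A) * (t - t₀)) * 2))
    ?_ ?_ ?_ ?_ t x ⟨ht, abs_le.1 hx⟩
  · exact hg.add (by fun_prop)
  · intro t x
    have h2 : D2 (fun x => 1 + x ^ 2) x 2 := by simpa using D2.quad 1 0 1 x
    exact (hgx t x).add ((h2.const_mul _).const_mul _)
  · intro t x
    exact (hgt t x).fun_add (((hexp _ t₀ t).mul_const _).const_mul _)
  · rintro t x ⟨ht, hx⟩ hneg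
    simp only at ht hx
    have hu0 := h0 t ht x (abs_le.2 hx)
    have hE : 1 ≤ Real.exp ((2 * d + A) * (t - t₀)) :=
      Real.one_le_exp (mul_nonneg (by linarith) (by linarith [ht.1]))
    have hgg := hg0 t x
    have hP : μ * (1 + x ^ 2) ≤ μ * (Real.exp ((2 * d + A) * (t - t₀)) * (1 + x ^ 2)) := by
      apply mul_le_mul_of_nonneg_left _ hμ0
      nlinarith [sq_nonneg x]
    have hxR : x ^ 2 ≠ R ^ 2 := by
      intro h
      rw [h, hμR] at hP
      rw [h] at hneg
      linarith
    have hx1 : -R < x := lt_of_le_of_ne hx.1 (fun h => hxR (by rw [← h]; ring))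
    have hx2 : x < R := lt_of_le_of_ne hx.2 (fun h => hxR (by rw [← h]))
    have ht1 : t₀ < t := by
      rcases ht.1.lt_or_eq with h | h
      · exact h
      · exfalso
        subst h
        have h2 := h1 x (abs_le.2 hx)
        have : 0 ≤ μ * (1 + x ^ 2) := by positivity
        linarith
    refine ⟨ht1, ?_, ?_, ?_⟩
    · filter_upwards [Ioo_mem_nhds hx1 hx2] with y hy
      exact ⟨ht, hy.1.le, hy.2.le⟩
    · filter_upwards [Ioo_mem_nhdsLT ht1] with s hs
      exact ⟨⟨hs.1.le, hs.2.le.trans ht.2⟩, hx⟩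
    · have h3 := hsup t x
      have ha := abs_le.1 (hA t x)
      set E := Real.exp ((2 * d + A) * (t - t₀))
      have h4 : 0 ≤ (2 * d + A) * (1 + x ^ 2) - 2 * d - a t x * (1 + x ^ 2) := by
        nlinarith [mul_nonneg (by linarith : 0 ≤ A - a t x) (by positivity : 0 ≤ 1 + x ^ 2),
          mul_nonneg hd.le (sq_nonneg x)]
      have h5 := mul_nonneg (mul_nonneg hμ0 (by linarith : 0 ≤ E)) h4
      nlinarith

/-- Bound on a box from bounds on its parabolic boundary. -/
lemma boxbound {d A T₀ t₀ τ C l r : ℝ} (hd : 0 < d) {a u : ℝ → ℝ → ℝ} (hA : ∀ t x, |a t x| ≤ A)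
    (hu : Good d a T₀ u) (ht₀ : T₀ ≤ t₀) (hC : 0 ≤ C)
    (h0 : ∀ x ∈ Icc l r, u t₀ x ≤ C)
    (hl : ∀ t ∈ Icc t₀ (t₀ + τ), u t l ≤ C) (hr : ∀ t ∈ Icc t₀ (t₀ + τ), u t r ≤ C)
    (t : ℝ) (ht : t ∈ Icc t₀ (t₀ + τ)) (x : ℝ) (hx : x ∈ Icc l r) :
    u t x ≤ C * Real.exp (A * τ) := by
  have hA0 : 0 ≤ A := (abs_nonneg _).trans (hA 0 0)
  have key := mpsol hd hA (hu.const_mul (-1)) ht₀ (Icc t₀ (t₀ + τ) ×ˢ Icc l r)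
    (isCompact_Icc.prod isCompact_Icc) (fun q hq => hq.1.1)
    (fun t _ => C * Real.exp (A * (t - t₀))) (fun t _ => C * (Real.exp (A * (t - t₀)) * A))
    (fun _ _ => 0) (by fun_prop) (fun t x => D2.const _ x) (fun t x => (hexp A t₀ t).const_mul C)
    ?_ t x ⟨ht, hx⟩
  · have : C * Real.exp (A * (t - t₀)) ≤ C * Real.exp (A * τ) := by
      have : t - t₀ ≤ τ := by linarith [ht.2]
      gcongr
    linarith
  · rintro t x ⟨ht, hx⟩ hneg
    simp only at ht hx
    have hE : 1 ≤ Real.exp (A * (t - t₀)) :=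
      Real.one_le_exp (mul_nonneg (by linarith) (by linarith [ht.1]))
    have hCE : C ≤ C * Real.exp (A * (t - t₀)) := by nlinarith
    have hx1 : l < x := lt_of_le_of_ne hx.1 (fun h => by
      have := hl t ht; rw [h] at this; linarith)
    have hx2 : x < r := lt_of_le_of_ne hx.2 (fun h => by
      have := hr t ht; rw [← h] at this; linarith)
    have ht1 : t₀ < t := lt_of_le_of_ne ht.1 (fun h => by
      have := h0 x hx; rw [h] at this; linarith)
    refine ⟨ht1, ?_, ?_, ?_⟩
    · filter_upwards [Ioo_mem_nhds hx1 hx2] with y hy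
      exact ⟨ht, hy.1.le, hy.2.le⟩
    · filter_upwards [Ioo_mem_nhdsLT ht1] with s hs
      exact ⟨⟨hs.1.le, hs.2.le.trans ht.2⟩, hx⟩
    · have ha := abs_le.1 (hA t x)
      have := mul_nonneg (mul_nonneg hC (by linarith : 0 ≤ Real.exp (A * (t - t₀)))) (by linarith : 0 ≤ A - a t x)
      nlinarith

end LPD

namespace LPD

/-- Local uniform limits of classical solutions. -/
def Gen (d : ℝ) (a : ℝ → ℝ → ℝ) (T₀ : ℝ) (u : ℝ → ℝ → ℝ) : Prop :=
  ∀ T R δ : ℝ, 0 < δ → ∃ u' : ℝ → ℝ → ℝ, Good d a T₀ u' ∧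
    ∀ t ∈ Icc T₀ T, ∀ x, |x| ≤ R → |u t x - u' t x| ≤ δ

lemma Good.gen {d T₀ : ℝ} {a u : ℝ → ℝ → ℝ} (hu : Good d a T₀ u) : Gen d a T₀ u :=
  fun _ _ δ hδ => ⟨u, hu, fun t _ x _ => by simpa using hδ.le⟩

lemma Gen.add {d T₀ : ℝ} {a u v : ℝ → ℝ → ℝ} (hu : Gen d a T₀ u) (hv : Gen d a T₀ v) :
    Gen d a T₀ (fun t x => u t x + v t x) := by
  intro T R δ hδ
  obtain ⟨u', h1, h2⟩ := hu T R (δ / 2) (by linarith)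
  obtain ⟨v', h3, h4⟩ := hv T R (δ / 2) (by linarith)
  refine ⟨_, h1.add h3, fun t ht x hx => ?_⟩
  have h5 := abs_le.1 (h2 t ht x hx)
  have h6 := abs_le.1 (h4 t ht x hx)
  rw [abs_le]
  constructor <;> linarith [h5.1, h5.2, h6.1, h6.2]

lemma Gen.const_mul {d T₀ : ℝ} {a u : ℝ → ℝ → ℝ} (c : ℝ) (hu : Gen d a T₀ u) :
    Gen d a T₀ (fun t x => c * u t x) := by
  intro T R δ hδ
  obtain ⟨u', h1, h2⟩ := hu T R (δ / (|c| + 1)) (by positivity)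
  refine ⟨_, h1.const_mul c, fun t ht x hx => ?_⟩
  have h5 := h2 t ht x hx
  rw [← mul_sub, abs_mul]
  calc |c| * |u t x - u' t x| ≤ (|c| + 1) * (δ / (|c| + 1)) := by
        apply mul_le_mul (by linarith) h5 (abs_nonneg _) (by positivity)
    _ = δ := by field_simp

lemma Gen.shift_t {d T₀ : ℝ} {a u : ℝ → ℝ → ℝ} {c : ℝ} (hc0 : 0 ≤ c)
    (hc : ∀ t x, a (t + c) x = a t x)
    (hu : Gen d a T₀ u) : Gen d a T₀ (fun t x => u (t + c) x) := by
  intro T R δ hδ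
  obtain ⟨u', h1, h2⟩ := hu (T + c) R δ hδ
  exact ⟨_, h1.shift_t hc0 hc, fun t ht x hx =>
    h2 (t + c) ⟨by linarith [ht.1], by linarith [ht.2]⟩ x hx⟩

lemma lim_helper {f : ℝ → ℝ} (hf : Continuous f) {v e : ℝ} (he : 0 < e)
    (h : ∀ ε, 0 < ε → ε < e → f ε ≤ v) : f 0 ≤ v := by
  have h1 : Tendsto f (𝓝[>] 0) (𝓝 (f 0)) := hf.continuousAt.tendsto.mono_left nhdsWithin_le_nhds
  refine le_of_tendsto h1 ?_
  filter_upwards [Ioo_mem_nhdsGT he] with ε hε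
  exact h ε hε.1 hε.2

lemma Gen.ge {d A T₀ t₀ T M δ : ℝ} (hd : 0 < d) {a u : ℝ → ℝ → ℝ} (hA : ∀ t x, |a t x| ≤ A)
    (hu : Gen d a T₀ u) (ht₀ : T₀ ≤ t₀) (hM0 : 0 ≤ M) (hδ : 0 ≤ δ)
    (hM : ∀ t ∈ Icc t₀ T, ∀ x, -M ≤ u t x) (h0 : ∀ x, -δ ≤ u t₀ x)
    (t : ℝ) (ht : t ∈ Icc t₀ T) (x : ℝ) : -(δ * Real.exp (A * (t - t₀))) ≤ u t x := by
  set E := Real.exp (A * (t - t₀)) with hE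
  set E' := Real.exp ((2 * d + A) * (t - t₀)) with hE'
  have key := lim_helper (f := fun ε => -ε - (δ + ε) * E - (M + ε) * ε ^ 2 * (E' * (1 + x ^ 2)))
    (v := u t x) (e := 1) (by fun_prop) one_pos ?_
  · simpa using key
  · intro ε hε _
    obtain ⟨u', hg, hu'⟩ := hu T (|x| + 1 / ε) ε hε
    have hb : ∀ s ∈ Icc t₀ T, ∀ y, |y| ≤ |x| + 1 / ε → |u s y - u' s y| ≤ ε :=
      fun s hs y hy => hu' s ⟨ht₀.trans hs.1, hs.2⟩ y hy
    have hx : |x| ≤ |x| + 1 / ε := by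
      have : 0 < 1 / ε := by positivity
      linarith
    have h1 := line (R := |x| + 1 / ε) (M := M + ε) (T := T) hd hA hg ht₀ (by linarith)
      (fun t _ => (δ + ε) * Real.exp (A * (t - t₀)))
      (fun t _ => (δ + ε) * (Real.exp (A * (t - t₀)) * A)) (fun _ _ => 0) (by fun_prop)
      (fun t x => D2.const _ x) (fun t x => (hexp A t₀ t).const_mul _)
      (fun t x => by positivity)
      (fun t x => by
        have ha := abs_le.1 (hA t x)
        have := mul_nonneg (mul_nonneg (by linarith : 0 ≤ δ + ε)
          (Real.exp_pos (A * (t - t₀))).le) (by linarith : 0 ≤ A - a t x)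
        linarith)
      (fun s hs y hy => by
        have h2 := abs_le.1 (hb s hs y hy)
        have h3 := hM s hs y
        linarith [h2.1, h2.2])
      (fun y hy => by
        have h2 := abs_le.1 (hb t₀ ⟨le_rfl, ht.1.trans ht.2⟩ y hy)
        have h3 := h0 y
        simp
        linarith [h2.1, h2.2]) t ht x hx
    have h2 := abs_le.1 (hb t ht x hx)
    have h3 : (M + ε) / (1 + (|x| + 1 / ε) ^ 2) ≤ (M + ε) * ε ^ 2 := by
      rw [div_le_iff₀ (by positivity)]
      have h4 : (1 / ε) ^ 2 ≤ (|x| + 1 / ε) ^ 2 :=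
        pow_le_pow_left₀ (by positivity) (by linarith [abs_nonneg x]) 2
      have h5 : 1 ≤ ε ^ 2 * (1 + (|x| + 1 / ε) ^ 2) := by
        have : ε ^ 2 * (1 / ε) ^ 2 = 1 := by field_simp
        nlinarith [sq_nonneg ε]
      nlinarith
    have h6 : (M + ε) / (1 + (|x| + 1 / ε) ^ 2) * (E' * (1 + x ^ 2)) ≤ (M + ε) * ε ^ 2 * (E' * (1 + x ^ 2)) :=
      mul_le_mul_of_nonneg_right h3 (by positivity)
    linarith [h2.1, h2.2]

lemma Gen.le {d A T₀ t₀ T M m : ℝ} (hd : 0 < d) {a u : ℝ → ℝ → ℝ} (hA : ∀ t x, |a t x| ≤ A)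
    (hu : Gen d a T₀ u) (ht₀ : T₀ ≤ t₀) (hM0 : 0 ≤ M) (hm : 0 ≤ m)
    (hM : ∀ t ∈ Icc t₀ T, ∀ x, u t x ≤ M) (h0 : ∀ x, u t₀ x ≤ m)
    (t : ℝ) (ht : t ∈ Icc t₀ T) (x : ℝ) : u t x ≤ m * Real.exp (A * (t - t₀)) := by
  have := (hu.const_mul (-1)).ge hd hA ht₀ hM0 hm (fun t ht x => by linarith [hM t ht x])
    (fun x => by linarith [h0 x]) t ht x
  linarith

lemma Gen.lip {d A T₀ t₀ τ M : ℝ} (hd : 0 < d) {a u : ℝ → ℝ → ℝ} (hA : ∀ t x, |a t x| ≤ A)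
    (hτ : 0 < τ) (hu : Gen d a T₀ u) (ht₀ : T₀ ≤ t₀)
    (hM : ∀ t ∈ Icc t₀ (t₀ + τ), ∀ x, |u t x| ≤ M) {x y : ℝ} (hyx : y ≤ x) (hxy : x ≤ y + 2) :
    u (t₀ + τ) x - u (t₀ + τ) y ≤ ((1 + A * τ) / d + 2 * τ) / τ * M * (x - y) := by
  set Λ := ((1 + A * τ) / d + 2 * τ) / τ with hΛ
  have key := lim_helper (f := fun ε => u (t₀ + τ) x - u (t₀ + τ) y - Λ * (M + ε) * (x - y) - 2 * ε)
    (v := 0) (e := 1) (by fun_prop) one_pos ?_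
  · simp at key
    linarith
  · intro ε hε _
    obtain ⟨u', hg, hu'⟩ := hu (t₀ + τ) (|x| + |y| + 3) ε hε
    have hx1 := abs_le.1 (le_refl |x|)
    have hy1 := abs_le.1 (le_refl |y|)
    have h1 := LPD.lip (M := M + ε) (c := (x + y) / 2) (r := (x - y) / 2) hd hA hτ hg ht₀
      (fun t ht z hz => by
        have hz' := abs_le.1 hz
        have h2 := abs_le.1 (hu' t ⟨ht₀.trans ht.1, ht.2⟩ z (by
          rw [abs_le]; constructor <;> linarith [hz'.1, hz'.2]))
        have h3 := abs_le.1 (hM t ht z)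
        rw [abs_le]; constructor <;> linarith [h2.1, h2.2, h3.1, h3.2])
      ⟨by linarith, by linarith⟩
    rw [show (x - y) / 2 + (x + y) / 2 = x by ring, show (x + y) / 2 - (x - y) / 2 = y by ring] at h1
    have h2 := abs_le.1 (hu' (t₀ + τ) ⟨by linarith, le_rfl⟩ x (by linarith [abs_nonneg y]))
    have h3 := abs_le.1 (hu' (t₀ + τ) ⟨by linarith, le_rfl⟩ y (by linarith [abs_nonneg x]))
    have h4 : 2 * ((1 + A * τ) / d + 2 * τ) / τ * (M + ε) * ((x - y) / 2) = Λ * (M + ε) * (x - y) := by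
      rw [hΛ]; ring
    linarith [h2.1, h2.2, h3.1, h3.2]

lemma Gen.lower {d A T₀ t₀ τ η ρ R y : ℝ} (hd : 0 < d) {a u : ℝ → ℝ → ℝ} (hA : ∀ t x, |a t x| ≤ A)
    (hτ : 0 < τ) (hu : Gen d a T₀ u) (ht₀ : T₀ ≤ t₀) (hη : 0 < η) (hρ : 0 < ρ)
    (h0 : ∀ t ∈ Icc t₀ (t₀ + τ), ∀ x, 0 ≤ u t x)
    (h1 : ∀ x, |x - y| ≤ ρ → η ≤ u t₀ x) (x : ℝ) (hx : |x - y| ≤ R) :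
    η * Real.exp (-(A + (R ^ 2 / τ + 6 * d) ^ 2 / (8 * d * ρ ^ 2)) * τ) ≤ u (t₀ + τ) x := by
  set E := Real.exp (-(A + (R ^ 2 / τ + 6 * d) ^ 2 / (8 * d * ρ ^ 2)) * τ) with hE
  have key := lim_helper (f := fun ε => (η - ε) * E - ε * Real.exp (A * τ) - ε)
    (v := u (t₀ + τ) x) (e := η) (by fun_prop) hη ?_
  · simpa using key
  · intro ε hε hεη
    have hR0 : 0 ≤ R := (abs_nonneg _).trans hx
    obtain ⟨u', hg, hu'⟩ := hu (t₀ + τ) (|y| + ρ + R + ρ ^ 2 + R ^ 2 + 1) ε hε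
    have hy1 := abs_le.1 (le_refl |y|)
    have h2 := LPD.lower (δ := ε) (η := η - ε) (R := R) (y := y) hd hA hτ hg ht₀ hε.le (by linarith) hρ
      (fun t ht z hz => by
        have h2 := abs_le.1 (hu' t ⟨ht₀.trans ht.1, ht.2⟩ z (by
          rw [abs_le]
          constructor <;> nlinarith [sq_nonneg (z - y - 1), sq_nonneg (z - y + 1)]))
        have h3 := h0 t ht z
        linarith [h2.1, h2.2])
      (fun z hz => by
        have hz' := abs_le.1 hz
        have h2 := abs_le.1 (hu' t₀ ⟨ht₀, by linarith⟩ z (by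
          rw [abs_le]
          constructor <;> nlinarith [sq_nonneg R, sq_nonneg ρ, hz'.1, hz'.2]))
        have h3 := h1 z hz
        linarith [h2.1, h2.2]) x hx
    have hx' := abs_le.1 hx
    have h3 := abs_le.1 (hu' (t₀ + τ) ⟨by linarith, le_rfl⟩ x (by
          rw [abs_le]
          constructor <;> nlinarith [sq_nonneg R, sq_nonneg ρ, hx'.1, hx'.2]))
    linarith [h3.1, h3.2]

lemma harnack {d A τ η R : ℝ} (hd : 0 < d) (hA0 : 0 ≤ A) (hτ : 0 < τ) (hη : 0 < η) :
    ∃ c > 0, ∀ (T₀ t₀ M : ℝ) (a u : ℝ → ℝ → ℝ), (∀ t x, |a t x| ≤ A) → Gen d a T₀ u → T₀ ≤ t₀ →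
      0 < M → (∀ t ∈ Icc t₀ (t₀ + 2 * τ), ∀ x, 0 ≤ u t x) →
      (∀ t ∈ Icc t₀ (t₀ + τ), ∀ x, u t x ≤ M) → ∀ y, η * M ≤ u (t₀ + τ) y →
      ∀ x, |x - y| ≤ R → c * M ≤ u (t₀ + 2 * τ) x := by
  set Λ := ((1 + A * τ) / d + 2 * τ) / τ with hΛ
  have hΛ0 : 0 < Λ := by positivity
  set ρ := min 1 (η / (2 * Λ)) with hρ
  have hρ0 : 0 < ρ := by positivity
  have hρ1 : ρ ≤ 1 := min_le_left _ _
  have hρ2 : Λ * ρ ≤ η / 2 := by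
    calc Λ * ρ ≤ Λ * (η / (2 * Λ)) := by gcongr; exact min_le_right _ _
      _ = η / 2 := by field_simp
  refine ⟨η / 2 * Real.exp (-(A + (R ^ 2 / τ + 6 * d) ^ 2 / (8 * d * ρ ^ 2)) * τ), by positivity, ?_⟩
  intro T₀ t₀ M a u hA hu ht₀ hM hpos hle y hy x hx
  have hab : ∀ t ∈ Icc t₀ (t₀ + τ), ∀ x, |u t x| ≤ M := fun t ht x => by
    rw [abs_of_nonneg (hpos t ⟨ht.1, by linarith [ht.2]⟩ x)]
    exact hle t ht x
  have hball : ∀ z, |z - y| ≤ ρ → η / 2 * M ≤ u (t₀ + τ) z := by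
    intro z hz
    have hz' := abs_le.1 hz
    have hMρ : Λ * M * |z - y| ≤ η / 2 * M := by
      calc Λ * M * |z - y| ≤ Λ * M * ρ := by gcongr
        _ = (Λ * ρ) * M := by ring
        _ ≤ _ := by gcongr
    rcases le_total y z with h | h
    · have := (hu.const_mul (-1)).lip (M := M) hd hA hτ ht₀
        (fun t ht x => by simpa using hab t ht x) h (by linarith)
      rw [← hΛ] at this
      rw [abs_of_nonneg (by linarith)] at hMρ
      linarith
    · have := hu.lip (M := M) hd hA hτ ht₀ hab h (by linarith)
      rw [← hΛ] at this
      rw [abs_of_nonpos (by linarith)] at hMρ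
      linarith
  have := hu.lower (η := η / 2 * M) (R := R) (y := y) (t₀ := t₀ + τ) hd hA hτ (by linarith) (by positivity) hρ0
    (fun t ht x => hpos t ⟨by linarith [ht.1], by linarith [ht.2]⟩ x) hball x hx
  rw [show t₀ + 2 * τ = t₀ + τ + τ by ring]
  linarith

end LPD

namespace LPD

lemma Gen.nonneg {d A T₀ t₀ : ℝ} (hd : 0 < d) {a u : ℝ → ℝ → ℝ} (hA : ∀ t x, |a t x| ≤ A)
    (hu : Gen d a T₀ u) (ht₀ : T₀ ≤ t₀)
    (hM : ∀ T, ∃ M, ∀ t ∈ Icc t₀ T, ∀ x, -M ≤ u t x) (h0 : ∀ x, 0 ≤ u t₀ x)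
    (t : ℝ) (ht : t₀ ≤ t) (x : ℝ) : 0 ≤ u t x := by
  obtain ⟨M, hM⟩ := hM t
  have := hu.ge (T := t) (M := |M|) (δ := 0) hd hA ht₀ (abs_nonneg _) le_rfl
    (fun s hs y => (neg_le_neg (le_abs_self M)).trans (hM s hs y)) (by simpa using h0) t ⟨ht, le_rfl⟩ x
  simpa using this

lemma near_translate {L : ℝ} (hL : 0 < L) (x y : ℝ) : ∃ k : ℤ, |x + k * L - y| ≤ L := by
  refine ⟨⌊(y - x) / L⌋, ?_⟩
  have h1 := Int.floor_le ((y - x) / L)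
  have h2 := Int.lt_floor_add_one ((y - x) / L)
  rw [le_div_iff₀ hL] at h1
  rw [div_lt_iff₀ hL] at h2
  rw [abs_le]
  constructor <;> linarith

/-- Decay from the periodised sum `V` of the translates of `W`. -/
lemma core {d A T₀ ω L K B : ℝ} (hd : 0 < d) (hω : 0 < ω) (hL : 0 < L) (hK : 0 < K) (hB : 0 ≤ B)
    {a W V : ℝ → ℝ → ℝ} (hA : ∀ t x, |a t x| ≤ A) (hat : ∀ t x, a (t + ω) x = a t x)
    (hW : Gen d a T₀ W) (hW0 : ∀ t ≥ T₀, ∀ x, 0 ≤ W t x) (hWB : ∀ t ≥ T₀, ∀ x, W t x ≤ B)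
    (hWc : Continuous (W T₀)) {y₀ : ℝ} (hy₀ : 0 < W T₀ y₀)
    (hV : Gen d a T₀ V) (hVper : ∀ t x, ∀ k : ℤ, V t (x + k * L) = V t x)
    (hVexp : ∀ ϑ, 0 < ϑ → ϑ ≤ 1 → ∃ D, ∀ t ≥ T₀, ∀ x, V t x ≤ D * Real.exp (ϑ * K * (t - T₀)))
    (hVsum : ∀ t ≥ T₀, ∀ x, ∀ s : Finset ℤ, ∑ k ∈ s, W t (x + k * L) ≤ V t x) :
    ∀ ε > 0, ∃ T, ∀ t ≥ T, ∀ x : ℝ, |W t x| ≤ ε := by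
  have hA0 : 0 ≤ A := (abs_nonneg _).trans (hA 0 0)
  have hWV : ∀ t ≥ T₀, ∀ x, W t x ≤ V t x := fun t ht x => by
    simpa using hVsum t ht x {0}
  have hV0 : ∀ t ≥ T₀, ∀ x, 0 ≤ V t x := fun t ht x => (hW0 t ht x).trans (hWV t ht x)
  have hVbd : ∀ T, ∃ M, 0 ≤ M ∧ ∀ t ∈ Icc T₀ T, ∀ x, V t x ≤ M := by
    obtain ⟨D, hD⟩ := hVexp 1 one_pos le_rfl
    intro T
    refine ⟨|D| * Real.exp (1 * K * (T - T₀)), by positivity, fun t ht x => (hD t ht.1 x).trans ?_⟩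
    have : t - T₀ ≤ T - T₀ := by linarith [ht.2]
    have h2 := le_abs_self D
    gcongr
  have hatn : ∀ n : ℕ, ∀ t x, a (t + n * ω) x = a t x := by
    intro n
    induction n with
    | zero => intro t x; simp
    | succ n ih =>
      intro t x
      rw [← ih t x, ← hat (t + n * ω) x]
      congr 1
      push_cast; ring
  have htn : ∀ n : ℕ, T₀ ≤ T₀ + n * ω := fun n => by
    have : 0 ≤ n * ω := by positivity
    linarith
  -- comparison in time
  have hcmp : ∀ (c : ℝ) (n : ℕ), 0 ≤ c → (∀ x, c * V T₀ x ≤ V (T₀ + n * ω) x) →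
      ∀ t ≥ T₀, ∀ x, c * V t x ≤ V (t + n * ω) x := by
    intro c n hc h t ht x
    have hg : Gen d a T₀ (fun t x => V (t + n * ω) x + (-c) * V t x) :=
      (hV.shift_t (by positivity) (hatn n)).add (hV.const_mul (-c))
    have := hg.nonneg hd hA le_rfl (fun T => by
      obtain ⟨M, hM0, hM⟩ := hVbd T
      refine ⟨c * M, fun s hs y => ?_⟩
      have h1 := hV0 (s + n * ω) (by have : 0 ≤ n * ω := by positivity
                                     linarith [hs.1]) y
      have h2 := mul_le_mul_of_nonneg_left (hM s hs y) hc
      linarith) (fun y => by linarith [h y]) t ht x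
    linarith
  have hVt : ∀ n : ℕ, ∃ M, ∀ x, V (T₀ + n * ω) x ≤ M := fun n => by
    obtain ⟨M, -, hM⟩ := hVbd (T₀ + n * ω)
    exact ⟨M, fun x => hM _ ⟨htn n, le_rfl⟩ x⟩
  set M : ℕ → ℝ := fun n => ⨆ x, V (T₀ + n * ω) x with hMdef
  have hbdd : ∀ n : ℕ, BddAbove (range fun x => V (T₀ + n * ω) x) := fun n => by
    obtain ⟨C, hC⟩ := hVt n
    exact ⟨C, by rintro _ ⟨x, rfl⟩; exact hC x⟩
  have hVM : ∀ n : ℕ, ∀ x, V (T₀ + n * ω) x ≤ M n := fun n x => le_ciSup (hbdd n) x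
  have hM0 : ∀ n, 0 ≤ M n := fun n => (hV0 _ (htn n) 0).trans (hVM n 0)
  have hM00 : 0 < M 0 := by
    have h1 := hVM 0 y₀
    have h2 := hWV T₀ le_rfl y₀
    simp at h1
    linarith
  -- positive lower bound after one period
  obtain ⟨c₀, hc₀, hc₀V⟩ : ∃ c > 0, ∀ x, c ≤ V (T₀ + ω) x := by
    have hev : ∀ᶠ x in 𝓝 y₀, W T₀ y₀ / 2 < W T₀ x :=
      hWc.continuousAt.eventually (lt_mem_nhds (by linarith))
    obtain ⟨ρ, hρ, hball⟩ := Metric.eventually_nhds_iff.1 hev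
    have := hV.lower (t₀ := T₀) (τ := ω) (η := W T₀ y₀ / 2) (ρ := ρ / 2) (R := L) (y := y₀) hd hA hω le_rfl
      (by linarith) (by linarith) (fun t ht x => hV0 t ht.1 x) (fun x hx => by
        have h1 := hball (y := x) (by rw [Real.dist_eq]; linarith)
        linarith [hWV T₀ le_rfl x])
    refine ⟨W T₀ y₀ / 2 * Real.exp (-(A + (L ^ 2 / ω + 6 * d) ^ 2 / (8 * d * (ρ / 2) ^ 2)) * ω),
      mul_pos (by linarith) (Real.exp_pos _), fun x => ?_⟩
    obtain ⟨k, hk⟩ := near_translate hL x y₀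
    have h2 := this _ hk
    rw [hVper] at h2
    exact h2
  set θ := c₀ / M 0 with hθ
  have hθ0 : 0 < θ := by positivity
  have hgrow : ∀ t ≥ T₀, ∀ x, θ * V t x ≤ V (t + ω) x := by
    have := hcmp θ 1 hθ0.le (fun x => by
      have h1 := hVM 0 x
      simp only [Nat.cast_zero, zero_mul, add_zero] at h1
      have h2 : θ * M 0 = c₀ := by rw [hθ]; field_simp
      have h3 := mul_le_mul_of_nonneg_left h1 hθ0.le
      have h4 := hc₀V x
      simp only [Nat.cast_one, one_mul]
      linarith)
    simpa using this
  set e := Real.exp (A * ω) with he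
  have he0 : 0 < e := Real.exp_pos _
  have hup : ∀ n : ℕ, ∀ t ∈ Icc (T₀ + n * ω) (T₀ + n * ω + ω), ∀ x, V t x ≤ e * M n := by
    intro n t ht x
    obtain ⟨C, hC0, hC⟩ := hVbd (T₀ + n * ω + ω)
    have h1 := hV.le (T := T₀ + n * ω + ω) (M := C) (m := M n) hd hA (htn n) hC0 (hM0 n)
      (fun s hs y => hC s ⟨(htn n).trans hs.1, hs.2⟩ y) (hVM n) t ht x
    refine h1.trans ?_
    rw [mul_comm]
    have : t - (T₀ + n * ω) ≤ ω := by linarith [ht.2]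
    have h3 := hM0 n
    rw [he]
    gcongr
  have hsucc : ∀ n : ℕ, T₀ + ((n + 1 : ℕ) : ℝ) * ω = T₀ + n * ω + ω := fun n => by
    push_cast; ring
  have hsucc2 : ∀ n : ℕ, T₀ + ((n + 2 : ℕ) : ℝ) * ω = T₀ + n * ω + 2 * ω := fun n => by
    push_cast; ring
  have hMup : ∀ n, M (n + 1) ≤ e * M n := fun n => by
    apply ciSup_le
    intro x
    rw [hsucc]
    exact hup n _ ⟨by linarith, le_rfl⟩ x
  have hMlow : ∀ n, θ * M n ≤ M (n + 1) := fun n => by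
    rw [← le_div_iff₀' hθ0]
    apply ciSup_le
    intro x
    rw [le_div_iff₀' hθ0]
    have h1 := hgrow _ (htn n) x
    rw [← hsucc] at h1
    exact h1.trans (hVM _ x)
  have hMpos : ∀ n, 0 < M n := by
    intro n
    induction n with
    | zero => exact hM00
    | succ n ih => exact (mul_pos hθ0 ih).trans_le (hMlow n)
  have hMatt : ∀ n, ∃ y, M n / 2 ≤ V (T₀ + n * ω) y := fun n => by
    obtain ⟨y, hy⟩ := exists_lt_of_lt_ciSup (f := fun x => V (T₀ + n * ω) x) (b := M n / 2)
      (by have := hMpos n; change M n / 2 < M n; linarith)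
    exact ⟨y, hy.le⟩
  -- Harnack inequality for V
  obtain ⟨c₁, hc₁, hH⟩ : ∃ c > 0, ∀ n x, c * M (n + 2) ≤ V (T₀ + ((n + 2 : ℕ) : ℝ) * ω) x := by
    obtain ⟨c, hc, h⟩ := harnack (d := d) (A := A) (τ := ω) (η := θ / (2 * e)) (R := L) hd hA0 hω
      (by positivity)
    refine ⟨c / e, by positivity, fun n x => ?_⟩
    obtain ⟨y, hy⟩ := hMatt (n + 1)
    obtain ⟨k, hk⟩ := near_translate hL x y
    have h1 := h T₀ (T₀ + n * ω) (e * M n) a V hA hV (htn n) (mul_pos he0 (hMpos n))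
      (fun t ht x => hV0 t ((htn n).trans ht.1) x) (hup n) y (by
        rw [← hsucc]
        refine le_trans ?_ hy
        have h2 := hMlow n
        calc θ / (2 * e) * (e * M n) = θ * M n / 2 := by field_simp
          _ ≤ _ := by linarith) _ hk
    rw [hVper, ← hsucc2] at h1
    refine le_trans ?_ h1
    have h2 := hMup n
    have h3 := hMup (n + 1)
    calc c / e * M (n + 2) ≤ c / e * (e * (e * M n)) := by
          gcongr
          exact h3.trans (by gcongr)
      _ = c * (e * M n) := by field_simp
  -- V is bounded
  have hMbd : ∀ n, c₁ * M (n + 2) ≤ 2 * M 0 := by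
    intro n
    by_contra hcon
    push Not at hcon
    have h1 := hcmp 2 (n + 2) (by norm_num) (fun x => by
      have h2 := hVM 0 x
      have h3 := hH n x
      simp only [Nat.cast_zero, zero_mul, add_zero] at h2
      linarith)
    set p : ℝ := ((n + 2 : ℕ) : ℝ) * ω with hp
    have hp0 : 0 < p := by positivity
    have hpow : ∀ j : ℕ, 2 ^ j * V T₀ y₀ ≤ V (T₀ + j * p) y₀ := by
      intro j
      induction j with
      | zero => simp
      | succ j ih =>
        have h2 := h1 (T₀ + j * p) (by have : 0 ≤ j * p := by positivity
                                       linarith) y₀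
        have h3 : T₀ + ((j + 1 : ℕ) : ℝ) * p = T₀ + j * p + p := by push_cast; ring
        rw [h3, pow_succ]
        linarith
    have hl : 0 < Real.log (3 / 2) := Real.log_pos (by norm_num)
    set ϑ := min 1 (Real.log (3 / 2) / (K * p)) with hϑ
    have hϑ0 : 0 < ϑ := by positivity
    obtain ⟨D, hD⟩ := hVexp ϑ hϑ0 (min_le_left _ _)
    have hϑp : Real.exp (ϑ * K * p) ≤ 3 / 2 := by
      rw [← Real.exp_log (by norm_num : (0 : ℝ) < 3 / 2)]
      apply Real.exp_le_exp.2
      calc ϑ * K * p = ϑ * (K * p) := by ring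
        _ ≤ Real.log (3 / 2) / (K * p) * (K * p) := by gcongr; exact min_le_right _ _
        _ = _ := by field_simp
    have hv : 0 < V T₀ y₀ := hy₀.trans_le (hWV T₀ le_rfl y₀)
    have hall : ∀ j : ℕ, (4 / 3 : ℝ) ^ j ≤ |D| / V T₀ y₀ := by
      intro j
      rw [le_div_iff₀ hv]
      have h2 := hpow j
      have h3 := hD (T₀ + j * p) (by have : 0 ≤ j * p := by positivity
                                     linarith) y₀
      have h4 : Real.exp (ϑ * K * (T₀ + j * p - T₀)) ≤ (3 / 2) ^ j := by
        calc _ = Real.exp (ϑ * K * p) ^ j := by rw [← Real.exp_nat_mul]; congr 1; ring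
          _ ≤ _ := pow_le_pow_left₀ (Real.exp_pos _).le hϑp j
      have h5 : (2 : ℝ) ^ j * V T₀ y₀ ≤ |D| * (3 / 2) ^ j := by
        refine (h2.trans h3).trans ?_
        have := le_abs_self D
        gcongr
      have h6 : (2 : ℝ) ^ j = (4 / 3) ^ j * (3 / 2) ^ j := by rw [← mul_pow]; norm_num
      rw [h6] at h5
      have h7 : (0 : ℝ) < (3 / 2) ^ j := by positivity
      refine le_of_mul_le_mul_right ?_ h7
      linarith
    obtain ⟨j, hj⟩ := pow_unbounded_of_one_lt (|D| / V T₀ y₀) (by norm_num : (1 : ℝ) < 4 / 3)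
    linarith [hall j]
  obtain ⟨CV, hCV0, hCV⟩ : ∃ C > 0, ∀ t ≥ T₀ + 2 * ω, ∀ x, V t x ≤ C := by
    refine ⟨e * (2 * M 0 / c₁), by positivity, fun t ht x => ?_⟩
    set n := ⌊(t - (T₀ + 2 * ω)) / ω⌋₊ with hn
    have h0 : 0 ≤ (t - (T₀ + 2 * ω)) / ω := div_nonneg (by linarith) hω.le
    have h1 := Nat.floor_le h0
    have h2 := Nat.lt_floor_add_one ((t - (T₀ + 2 * ω)) / ω)
    rw [← hn] at h1 h2
    rw [le_div_iff₀ hω] at h1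
    rw [div_lt_iff₀ hω] at h2
    refine (hup (n + 2) t ⟨by push_cast; linarith, by push_cast; linarith⟩ x).trans ?_
    gcongr
    rw [le_div_iff₀' hc₁]
    exact hMbd n
  -- comparison between W and V
  have hWcmp : ∀ (s : ℝ) (n : ℕ), 0 ≤ s → (∀ x, W (T₀ + n * ω) x ≤ s * V (T₀ + n * ω) x) →
      ∀ t ≥ T₀ + n * ω, ∀ x, W t x ≤ s * V t x := by
    intro s n hs h t ht x
    have hg : Gen d a T₀ (fun t x => s * V t x + (-1) * W t x) := (hV.const_mul s).add (hW.const_mul (-1))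
    have := hg.nonneg hd hA (htn n) (fun T => ⟨B, fun r hr y => by
      have h1 := mul_nonneg hs (hV0 r ((htn n).trans hr.1) y)
      have h2 := hWB r ((htn n).trans hr.1) y
      linarith⟩) (fun y => by linarith [h y]) t ht x
    linarith
  set SS : Set ℝ := {s | 0 ≤ s ∧ ∃ n : ℕ, ∀ x, W (T₀ + n * ω) x ≤ s * V (T₀ + n * ω) x} with hSS
  have hSne : SS.Nonempty := ⟨1, by norm_num, 0, fun x => by
    simpa using hWV T₀ le_rfl x⟩
  have hSbd : BddBelow SS := ⟨0, fun s hs => hs.1⟩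
  set S := sInf SS with hSdef
  have hS0 : 0 ≤ S := le_csInf hSne (fun s hs => hs.1)
  have hS1 : S ≤ 1 := csInf_le hSbd ⟨by norm_num, 0, fun x => by simpa using hWV T₀ le_rfl x⟩
  have hSzero : S = 0 := by
    by_contra hne
    have hSpos : 0 < S := lt_of_le_of_ne hS0 (Ne.symm hne)
    obtain ⟨N, hN⟩ := exists_nat_gt (2 / S)
    rw [div_lt_iff₀ hSpos] at hN
    set γ := S * c₁ / 2 with hγ
    have hγ0 : 0 < γ := by positivity
    obtain ⟨c₂, hc₂, hH2⟩ := harnack (d := d) (A := A) (τ := ω) (η := γ * θ / (2 * e)) (R := N * L) hd hA0 hω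
      (by positivity)
    set δ := min (c₂ / e) (min 1 (S / 2)) with hδ
    have hδ0 : 0 < δ := by positivity
    have hδ1 : δ ≤ c₂ / e := min_le_left _ _
    have hδ2 : δ ≤ 1 := (min_le_right _ _).trans (min_le_left _ _)
    have hδ3 : δ ≤ S / 2 := (min_le_right _ _).trans (min_le_right _ _)
    obtain ⟨s, ⟨hs0, n₀, hn₀⟩, hsS⟩ := exists_lt_of_csInf_lt hSne (show sInf SS < S + δ by linarith)
    have hSs : S ≤ s := csInf_le hSbd ⟨hs0, n₀, hn₀⟩
    set n := n₀ + 1 with hn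
    have hU := hWcmp s n₀ hs0 hn₀
    have hle : T₀ + n₀ * ω ≤ T₀ + n * ω := by rw [hn, hsucc]; linarith
    obtain ⟨x, hx⟩ : ∃ x, (S - δ) * V (T₀ + ((n + 2 : ℕ) : ℝ) * ω) x < W (T₀ + ((n + 2 : ℕ) : ℝ) * ω) x := by
      by_contra hcon
      push Not at hcon
      have : S ≤ S - δ := csInf_le hSbd ⟨by linarith, n + 2, hcon⟩
      linarith
    have hUg : Gen d a T₀ (fun t x => s * V t x + (-1) * W t x) := (hV.const_mul s).add (hW.const_mul (-1))
    have hsmall : ∀ y, |x - y| ≤ N * L →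
        s * V (T₀ + n * ω + ω) y + (-1) * W (T₀ + n * ω + ω) y ≤ γ * M (n + 1) := by
      intro y hy
      by_contra hcon
      push Not at hcon
      have h1 := hH2 T₀ (T₀ + n * ω) (2 * (e * M n)) a _ hA hUg (htn n)
        (by have := hMpos n; positivity)
        (fun t ht z => by linarith [hU t (hle.trans ht.1) z])
        (fun t ht z => by
          have h2 := hup n t ht z
          have h3 := hV0 t ((htn n).trans ht.1) z
          have h4 := hW0 t ((htn n).trans ht.1) z
          have h5 : s * V t z ≤ 2 * V t z := mul_le_mul_of_nonneg_right (by linarith) h3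
          linarith) y (by
          refine le_trans ?_ hcon.le
          calc γ * θ / (2 * e) * (2 * (e * M n)) = γ * (θ * M n) := by field_simp
            _ ≤ _ := mul_le_mul_of_nonneg_left (hMlow n) hγ0.le) x hy
      rw [← hsucc2] at h1
      have h2 := hVM (n + 2) x
      have h3 := (hMup (n + 1)).trans (mul_le_mul_of_nonneg_left (hMup n) he0.le)
      have h4 := hV0 _ (htn (n + 2)) x
      have h5 : (s - S + δ) * V (T₀ + ((n + 2 : ℕ) : ℝ) * ω) x ≤ 2 * δ * (e * (e * M n)) := by
        apply mul_le_mul (by linarith) (h2.trans h3) h4 (by positivity)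
      have h6 : 2 * δ * (e * (e * M n)) ≤ 2 * (c₂ / e) * (e * (e * M n)) := by
        have := hMpos n
        gcongr
      have h7 : 2 * (c₂ / e) * (e * (e * M n)) = c₂ * (2 * (e * M n)) := by field_simp
      linarith
    rw [← hsucc] at hsmall
    have hVp : 0 < V (T₀ + ((n + 1 : ℕ) : ℝ) * ω) x := by
      have h1 := hH n₀ x
      have h2 := mul_pos hc₁ (hMpos (n₀ + 2))
      exact h2.trans_le h1
    have hbig : ∀ k ∈ Finset.Ico (0 : ℤ) N,
        S / 2 * V (T₀ + ((n + 1 : ℕ) : ℝ) * ω) x ≤ W (T₀ + ((n + 1 : ℕ) : ℝ) * ω) (x + k * L) := by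
      intro k hk
      rw [Finset.mem_Ico] at hk
      have hk0 : (0 : ℝ) ≤ k := by exact_mod_cast hk.1
      have hkN : (k : ℝ) ≤ N := by exact_mod_cast hk.2.le
      have h1 := hsmall (x + k * L) (by
        rw [show x - (x + k * L) = -(k * L) by ring, abs_neg, abs_of_nonneg (by positivity)]
        gcongr)
      rw [hVper] at h1
      have h2 := hH n₀ x
      have h3 : γ * M (n + 1) ≤ S / 2 * V (T₀ + ((n + 1 : ℕ) : ℝ) * ω) x := by
        calc γ * M (n + 1) = S / 2 * (c₁ * M (n₀ + 2)) := by rw [hγ, hn]; ring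
          _ ≤ _ := mul_le_mul_of_nonneg_left h2 (by linarith)
      have h4 := mul_le_mul_of_nonneg_right hSs hVp.le
      linarith
    have h1 := Finset.card_nsmul_le_sum _ _ _ hbig
    have h2 := hVsum _ (htn (n + 1)) x (Finset.Ico (0 : ℤ) N)
    simp only [Int.card_Ico, nsmul_eq_mul, sub_zero, Int.toNat_natCast] at h1
    nlinarith
  intro ε hε
  obtain ⟨s, ⟨hs0, n, hn⟩, hsS⟩ := exists_lt_of_csInf_lt hSne
    (show sInf SS < ε / CV by rw [← hSdef, hSzero]; positivity)
  refine ⟨max (T₀ + n * ω) (T₀ + 2 * ω), fun t ht x => ?_⟩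
  have ht1 := (le_max_left _ _).trans ht
  have ht2 := (le_max_right _ _).trans ht
  have h1 := hWcmp s n hs0 hn t ht1 x
  rw [abs_of_nonneg (hW0 t ((htn n).trans ht1) x)]
  rw [lt_div_iff₀ hCV0] at hsS
  have h2 := mul_le_mul_of_nonneg_left (hCV t ht2 x) hs0
  linarith

end LPD

namespace LPD

lemma tail1 {d A T₀ B C σ : ℝ} (hd : 0 < d) {a W : ℝ → ℝ → ℝ} (hA : ∀ t x, |a t x| ≤ A)
    (hW : Good d a T₀ W) (hB : 0 ≤ B) (hC : 0 ≤ C) (hσ : σ ^ 2 = 1)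
    (hWB : ∀ t ≥ T₀, ∀ x, W t x ≤ B) (h0 : ∀ x, W T₀ x ≤ C * Real.exp (σ * (x - 0)))
    (t : ℝ) (ht : T₀ ≤ t) (x : ℝ) :
    W t x ≤ C * Real.exp ((d + A) * (t - T₀)) * Real.exp (σ * (x - 0)) := by
  set E' := Real.exp ((2 * d + A) * (t - T₀)) with hE'
  have key := lim_helper (f := fun ε => W t x - B * ε ^ 2 * (E' * (1 + x ^ 2)))
    (v := C * Real.exp ((d + A) * (t - T₀)) * Real.exp (σ * (x - 0))) (e := 1) (by fun_prop) one_pos ?_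
  · simpa using key
  · intro ε hε _
    have hx : |x| ≤ |x| + 1 / ε := by
      have : 0 < 1 / ε := by positivity
      linarith
    have h1 := line (R := |x| + 1 / ε) (M := B) (T := t) hd hA (hW.const_mul (-1)) le_rfl hB
      (fun t x => C * Real.exp ((d + A) * (t - T₀)) * Real.exp (σ * (x - 0)))
      (fun t x => C * (Real.exp ((d + A) * (t - T₀)) * (d + A)) * Real.exp (σ * (x - 0)))
      (fun t x => C * Real.exp ((d + A) * (t - T₀)) * (Real.exp (σ * (x - 0)) * σ * σ)) (by fun_prop)
      (fun t x => D2.const_mul _ ⟨fun y => Real.exp (σ * (y - 0)) * σ, fun y => hexp σ 0 y,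
        (hexp σ 0 x).mul_const σ⟩)
      (fun t x => ((hexp (d + A) T₀ t).const_mul C).mul_const _)
      (fun t x => by positivity)
      (fun t x => by
        have ha := abs_le.1 (hA t x)
        have h3 := mul_nonneg (mul_nonneg (mul_nonneg hC
          (Real.exp_pos ((d + A) * (t - T₀))).le) (Real.exp_pos (σ * (x - 0))).le)
          (by linarith : 0 ≤ A - a t x)
        have h4 : Real.exp (σ * (x - 0)) * σ * σ = Real.exp (σ * (x - 0)) := by
          rw [mul_assoc, ← pow_two, hσ, mul_one]
        rw [h4]
        linarith)
      (fun s hs y hy => by linarith [hWB s hs.1 y])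
      (fun y hy => by
        have := h0 y
        simp only [sub_self, mul_zero, Real.exp_zero]
        simp only [sub_zero] at *
        linarith) t ⟨ht, le_rfl⟩ x hx
    have h3 : B / (1 + (|x| + 1 / ε) ^ 2) ≤ B * ε ^ 2 := by
      rw [div_le_iff₀ (by positivity)]
      have h4 : (1 / ε) ^ 2 ≤ (|x| + 1 / ε) ^ 2 :=
        pow_le_pow_left₀ (by positivity) (by linarith [abs_nonneg x]) 2
      have h5 : 1 ≤ ε ^ 2 * (1 + (|x| + 1 / ε) ^ 2) := by
        have : ε ^ 2 * (1 / ε) ^ 2 = 1 := by field_simp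
        nlinarith [sq_nonneg ε]
      nlinarith
    have h6 : B / (1 + (|x| + 1 / ε) ^ 2) * (E' * (1 + x ^ 2)) ≤ B * ε ^ 2 * (E' * (1 + x ^ 2)) :=
      mul_le_mul_of_nonneg_right h3 (by positivity)
    linarith

lemma tail {d A T₀ B ρ : ℝ} (hd : 0 < d) {a W : ℝ → ℝ → ℝ} (hA : ∀ t x, |a t x| ≤ A)
    (hW : Good d a T₀ W) (hB : 0 ≤ B)
    (hWB : ∀ t ≥ T₀, ∀ x, W t x ≤ B) (h0 : ∀ x, ρ < |x| → W T₀ x = 0)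
    (t : ℝ) (ht : T₀ ≤ t) (x : ℝ) :
    W t x ≤ B * Real.exp ρ * Real.exp ((d + A) * (t - T₀) - |x|) := by
  have h : ∀ σ : ℝ, |σ| = 1 → W t x ≤ B * Real.exp ρ * Real.exp ((d + A) * (t - T₀)) * Real.exp (σ * (x - 0)) := by
    intro σ hσ
    refine tail1 hd hA hW hB (by positivity) (by rw [← sq_abs, hσ, one_pow]) hWB (fun y => ?_) t ht x
    by_cases hy : ρ < |y|
    · rw [h0 y hy]; positivity
    · push Not at hy
      rw [mul_assoc, ← Real.exp_add, sub_zero]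
      have h2 : |σ * y| = |y| := by rw [abs_mul, hσ, one_mul]
      have h3 := neg_abs_le (σ * y)
      have h4 : 1 ≤ Real.exp (ρ + σ * y) := Real.one_le_exp (by linarith)
      nlinarith [hWB T₀ le_rfl y]
  rw [sub_eq_add_neg, Real.exp_add, ← mul_assoc]
  rcases le_total 0 x with hx | hx
  · rw [abs_of_nonneg hx]; simpa using h (-1) (by simp)
  · rw [abs_of_nonpos hx]; simpa using h 1 (by simp)

lemma summable_exp {c : ℝ} (hc : 0 < c) : Summable (fun k : ℤ => Real.exp (-(c * |(k : ℝ)|))) := by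
  have h : Summable (fun n : ℕ => Real.exp (-(c * n))) := by
    have := summable_geometric_of_lt_one (Real.exp_pos (-c)).le (Real.exp_lt_one_iff.2 (by linarith))
    refine this.congr (fun n => ?_)
    rw [← Real.exp_nat_mul]
    congr 1; ring
  apply Summable.of_nat_of_neg
  · simpa using h
  · simpa using h

lemma per_int {L : ℝ} {f : ℝ → ℝ} (h : ∀ x, f (x + L) = f x) (k : ℤ) (x : ℝ) :
    f (x + k * L) = f x := by
  have : Function.Periodic f L := h
  exact this.int_mul k x

/-- Periodised sum: all required properties, given the tail bound. -/
lemma fin {d A T₀ ω L B ρ : ℝ} (hd : 0 < d) (hω : 0 < ω) (hL : 0 < L) (hB : 0 ≤ B)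
    {a W : ℝ → ℝ → ℝ} (hA : ∀ t x, |a t x| ≤ A) (hat : ∀ t x, a (t + ω) x = a t x)
    (hax : ∀ t x, a t (x + L) = a t x)
    (hW : Good d a T₀ W) (hW0 : ∀ t ≥ T₀, ∀ x, 0 ≤ W t x) (hWB : ∀ t ≥ T₀, ∀ x, W t x ≤ B)
    (h0 : ∀ x, ρ < |x| → W T₀ x = 0) :
    ∀ ε > 0, ∃ T, ∀ t ≥ T, ∀ x : ℝ, |W t x| ≤ ε := by
  have hA0 : 0 ≤ A := (abs_nonneg _).trans (hA 0 0)
  have hWc : Continuous (W T₀) := by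
    have := hW.1.comp_continuous (f := fun x : ℝ => (T₀, x)) (by fun_prop) (fun x => le_refl T₀)
    exact this
  by_cases hz : ∀ x, W T₀ x = 0
  · intro ε hε
    refine ⟨T₀, fun t ht x => ?_⟩
    have := hW.gen.le (T := t) (M := B) (m := 0) hd hA le_rfl hB le_rfl (fun s hs y => hWB s hs.1 y)
      (fun y => (hz y).le) t ⟨ht, le_rfl⟩ x
    rw [abs_of_nonneg (hW0 t ht x)]
    linarith
  push Not at hz
  obtain ⟨y₀, hy₀⟩ := hz
  have hy₀ : 0 < W T₀ y₀ := lt_of_le_of_ne (hW0 T₀ le_rfl y₀) (Ne.symm hy₀)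
  set K := d + A with hK
  have hK0 : 0 < K := by linarith
  set C := B * Real.exp |ρ| with hC
  have hC0 : 0 ≤ C := by positivity
  have hBC : B ≤ C := le_mul_of_one_le_right hB (Real.one_le_exp (abs_nonneg _))
  have htail : ∀ t ≥ T₀, ∀ x, W t x ≤ C * Real.exp (K * (t - T₀) - |x|) := fun t ht x =>
    tail hd hA hW hB hWB (fun x hx => h0 x (lt_of_le_of_lt (le_abs_self ρ) hx)) t ht x
  have hbd : ∀ ϑ, 0 < ϑ → ϑ ≤ 1 → ∀ t ≥ T₀, ∀ x, ∀ k : ℤ, W t (x + k * L) ≤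
      C * Real.exp (ϑ * (K * (t - T₀) + |x|)) * Real.exp (-(ϑ * L * |(k : ℝ)|)) := by
    intro ϑ h1 h2 t ht x k
    have h3 : L * |(k : ℝ)| - |x| ≤ |x + k * L| := by
      have : |(k : ℝ) * L| = L * |(k : ℝ)| := by rw [abs_mul, abs_of_pos hL, mul_comm]
      rw [← this]
      have := abs_sub_abs_le_abs_sub ((k : ℝ) * L) (-x)
      rw [abs_neg] at this
      rw [add_comm]
      simpa using this
    rw [mul_assoc, ← Real.exp_add]
    rcases le_total 0 (K * (t - T₀) - |x + k * L|) with h | h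
    · have h4 := hWB t ht (x + k * L)
      have hy : 0 ≤ K * (t - T₀) - |x + k * L| := h
      have hbase : ϑ * (K * (t - T₀) - |x + k * L|) ≤ ϑ * (K * (t - T₀) + |x|) + -(ϑ * L * |(k : ℝ)|) := by
        nlinarith
      have h6 : 1 ≤ Real.exp (ϑ * (K * (t - T₀) + |x|) + -(ϑ * L * |(k : ℝ)|)) :=
        Real.one_le_exp ((mul_nonneg h1.le hy).trans hbase)
      nlinarith
    · refine (htail t ht _).trans (mul_le_mul_of_nonneg_left (Real.exp_le_exp.2 ?_) hC0)
      have hbase : ϑ * (K * (t - T₀) - |x + k * L|) ≤ ϑ * (K * (t - T₀) + |x|) + -(ϑ * L * |(k : ℝ)|) := by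
        nlinarith
      nlinarith
  have hsumm : ∀ t ≥ T₀, ∀ x, Summable (fun k : ℤ => W t (x + k * L)) := fun t ht x =>
    Summable.of_nonneg_of_le (fun k => hW0 t ht _) (hbd 1 one_pos le_rfl t ht x)
      ((summable_exp (by simpa using hL)).mul_left _)
  set V : ℝ → ℝ → ℝ := fun t x => ∑' k : ℤ, W t (x + k * L) with hV
  have hVper : ∀ t x, ∀ k : ℤ, V t (x + k * L) = V t x := by
    intro t x k
    simp only [hV]
    rw [← (Equiv.addLeft k).tsum_eq (fun j : ℤ => W t (x + j * L))]
    apply tsum_congr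
    intro j
    congr 1
    simp
    ring
  refine core (V := V) hd hω hL hK0 hB hA hat hW.gen hW0 hWB hWc hy₀ ?_ hVper ?_ ?_
  · intro T R δ hδ
    have hu := tendstoUniformlyOn_tsum (f := fun (k : ℤ) (q : ℝ × ℝ) => W q.1 (q.2 + k * L))
      (u := fun k : ℤ => C * Real.exp (1 * (K * (T - T₀) + R)) * Real.exp (-(1 * L * |(k : ℝ)|)))
      (s := {q : ℝ × ℝ | q.1 ∈ Icc T₀ T ∧ |q.2| ≤ R})
      ((summable_exp (by simpa using hL)).mul_left _) (by
        rintro k ⟨t, x⟩ ⟨ht, hx⟩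
        simp only at ht hx ⊢
        rw [Real.norm_of_nonneg (hW0 t ht.1 _)]
        refine (hbd 1 one_pos le_rfl t ht.1 x k).trans ?_
        have : t ≤ T := ht.2
        gcongr)
    rw [Metric.tendstoUniformlyOn_iff] at hu
    obtain ⟨s, hs⟩ := (hu δ hδ).exists
    refine ⟨fun t x => ∑ k ∈ s, W t (x + k * L), Good.sum s (fun (k : ℤ) t x => W t (x + k * L))
      (fun k => hW.shift_x (fun t x => per_int (hax t) k x)), fun t ht x hx => ?_⟩
    have := hs (t, x) ⟨ht, hx⟩
    rw [Real.dist_eq] at this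
    exact this.le
  · intro ϑ h1 h2
    refine ⟨∑' k : ℤ, C * Real.exp (ϑ * L) * Real.exp (-(ϑ * L * |(k : ℝ)|)), fun t ht x => ?_⟩
    obtain ⟨k, hk⟩ := near_translate hL x 0
    rw [← hVper t x k, ← tsum_mul_right]
    rw [sub_zero] at hk
    refine (hsumm t ht _).tsum_le_tsum (fun j => ?_) (((summable_exp (by positivity)).mul_left _).mul_right _)
    refine (hbd ϑ h1 h2 t ht _ j).trans ?_
    have h3 : Real.exp (ϑ * (K * (t - T₀) + |x + k * L|)) ≤ Real.exp (ϑ * L) * Real.exp (ϑ * K * (t - T₀)) := by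
      rw [← Real.exp_add]
      apply Real.exp_le_exp.2
      nlinarith
    calc _ ≤ C * (Real.exp (ϑ * L) * Real.exp (ϑ * K * (t - T₀))) * Real.exp (-(ϑ * L * |(j : ℝ)|)) := by gcongr
      _ = _ := by ring
  · intro t ht x s
    exact (hsumm t ht x).sum_le_tsum s (fun k _ => hW0 t ht _)

lemma per_bdd {p : ℝ} (hp : 0 < p) {f : ℝ → ℝ} (hf : Continuous f) (h : ∀ x, f (x + p) = f x) :
    ∃ C, ∀ x, f x ≤ C := by
  obtain ⟨C, hC⟩ := (isCompact_Icc (a := (-p)) (b := p)).exists_bound_of_continuousOn hf.continuousOn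
  refine ⟨C, fun x => ?_⟩
  obtain ⟨k, hk⟩ := near_translate hp x 0
  rw [sub_zero] at hk
  rw [← per_int h k x]
  exact (le_abs_self _).trans (hC _ (abs_le.1 hk))

end LPD

/-- Step 3 of the proof of Proposition 2.2: decay of solutions of the linear space-time
periodic parabolic equation `W_t - d W_xx = a(t,x) W` whose zeroth-order coefficient
admits a positive space-time periodic solution `φ₁`, starting from a compactly supported
nonnegative initial datum dominated by a multiple of `φ₁`. -/
theorem linear_periodic_parabolic_decay
    (d ω L : ℝ) (hd : 0 < d) (hω : 0 < ω) (hL : 0 < L)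
    (a : ℝ → ℝ → ℝ)
    (ha_bdd : ∃ C, ∀ t x, |a t x| ≤ C)
    (ha_cont : Continuous fun q : ℝ × ℝ => a q.1 q.2)
    (ha_holder : ∃ α ∈ Set.Ioc (0:ℝ) 1, ∀ R > 0, ∃ C > 0, ∀ t x s y : ℝ,
      |t| ≤ R → |x| ≤ R → |s| ≤ R → |y| ≤ R →
      |a t x - a s y| ≤ C * (|t - s| ^ (α / 2) + |x - y| ^ α))
    (ha_per_t : ∀ t x, a (t + ω) x = a t x)
    (ha_per_x : ∀ t x, a t (x + L) = a t x)
    (φ₁ : ℝ → ℝ → ℝ)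
    (hφ₁_pos : ∀ t x, 0 < φ₁ t x)
    (hφ₁_per_t : ∀ t x, φ₁ (t + ω) x = φ₁ t x)
    (hφ₁_per_x : ∀ t x, φ₁ t (x + L) = φ₁ t x)
    (hφ₁_sol : SolvesPDE d (fun t x u => a t x * u) φ₁ Set.univ)
    (T₀ M₀ : ℝ) (hM₀ : 0 < M₀)
    (W : ℝ → ℝ → ℝ)
    (hW_sol : SolvesPDE d (fun t x u => a t x * u) W {q : ℝ × ℝ | T₀ < q.1})
    (hW_cont : ContinuousOn (fun q : ℝ × ℝ => W q.1 q.2) {q : ℝ × ℝ | T₀ ≤ q.1})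
    (hW_supp : HasCompactSupport (W T₀))
    (hW_nonneg : ∀ t ≥ T₀, ∀ x, 0 ≤ W t x)
    (hW_le : ∀ t ≥ T₀, ∀ x, W t x ≤ M₀ * φ₁ t x)
    (hW_decay : ∀ t > T₀, Tendsto (fun x => W t x) (cocompact ℝ) (𝓝 0)) :
    ∀ ε > 0, ∃ T, ∀ t ≥ T, ∀ x : ℝ, |W t x| ≤ ε := by
  obtain ⟨A, hA⟩ := ha_bdd
  have hG : LPD.Good d a T₀ W := by
    refine ⟨hW_cont, fun t ht x => ⟨deriv (deriv (W t)) x, ⟨deriv (W t), fun y => ?_, ?_⟩, ?_⟩⟩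
    · exact (hW_sol (t, y) ht).1.hasDerivAt
    · exact (hW_sol (t, x) ht).2.1.hasDerivAt
    · exact (hW_sol (t, x) ht).2.2
  obtain ⟨C₁, hC₁⟩ := LPD.per_bdd hω (f := fun t => φ₁ t 0)
    (continuous_iff_continuousAt.2 fun t => (hφ₁_sol (t, 0) (Set.mem_univ _)).2.2.continuousAt)
    (fun t => hφ₁_per_t t 0)
  obtain ⟨C₂, hC₂⟩ := LPD.per_bdd hL (f := φ₁ T₀)
    (continuous_iff_continuousAt.2 fun x => (hφ₁_sol (T₀, x) (Set.mem_univ _)).1.continuousAt)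
    (hφ₁_per_x T₀)
  obtain ⟨C, hC0, h1, h2⟩ : ∃ C, 0 ≤ C ∧ C₁ ≤ C ∧ C₂ ≤ C :=
    ⟨max C₁ C₂, le_max_of_le_left ((hφ₁_pos 0 0).le.trans (hC₁ 0)), le_max_left _ _, le_max_right _ _⟩
  have hlines : ∀ t ≥ T₀, ∀ k : ℤ, W t (k * L) ≤ M₀ * C := by
    intro t ht k
    refine (hW_le t ht _).trans (mul_le_mul_of_nonneg_left ?_ hM₀.le)
    have h3 := LPD.per_int (hφ₁_per_x t) k 0
    rw [zero_add] at h3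
    rw [h3]
    exact (hC₁ t).trans h1
  have hB : ∀ t ≥ T₀, ∀ x, W t x ≤ M₀ * C * Real.exp (A * ω) := by
    intro t ht x
    have f1 := Nat.floor_le (a := (t - T₀) / ω) (div_nonneg (by linarith) hω.le)
    have f2 := Nat.lt_floor_add_one ((t - T₀) / ω)
    have f3 := Int.floor_le (x / L)
    have f4 := Int.lt_floor_add_one (x / L)
    set n := ⌊(t - T₀) / ω⌋₊
    set k := ⌊x / L⌋
    rw [le_div_iff₀ hω] at f1
    rw [div_lt_iff₀ hω] at f2
    rw [le_div_iff₀ hL] at f3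
    rw [div_lt_iff₀ hL] at f4
    have hn : (0 : ℝ) ≤ n * ω := by positivity
    refine LPD.boxbound (t₀ := T₀ + n * ω) (τ := ω) (l := k * L) (r := (k + 1 : ℤ) * L) hd hA hG
      (by linarith) (by positivity) ?_ ?_ ?_ t ⟨by linarith, by linarith⟩ x
      ⟨f3, by push_cast; linarith⟩
    · intro y _
      refine (hW_le _ (by linarith) _).trans (mul_le_mul_of_nonneg_left ?_ hM₀.le)
      have h3 := LPD.per_int (f := fun t => φ₁ t y) (fun t => hφ₁_per_t t y) n T₀
      simp only [Int.cast_natCast] at h3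
      rw [h3]
      exact (hC₂ y).trans h2
    · exact fun s hs => hlines s (by linarith [hs.1]) k
    · exact fun s hs => hlines s (by linarith [hs.1]) (k + 1)
  obtain ⟨ρ, hρ⟩ := hW_supp.isCompact.isBounded.exists_norm_le
  refine LPD.fin (ρ := ρ) hd hω hL (by positivity) hA ha_per_t ha_per_x hG hW_nonneg hB
    (fun x hx => ?_)
  by_contra hne
  have := hρ x (subset_tsupport _ hne)
  rw [Real.norm_eq_abs] at this
  linarith
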